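/- Let S be a multiplicative subset of a commutative ring A with A → S⁻¹A injective, and let Q be a pure ideal of A with Q·S⁻¹A = Q. Then A is strong n-perfect if and only if both S⁻¹A and A/Q are strong n-perfect. -/

import Mathlib

open CategoryTheory CategoryTheory.Limits

noncomputable section

universe u

/-- `pdLE R M n` : the projective dimension of the `R`-module `M` is at most `n`,
expressed by the vanishing of `Ext^{n+1}(M, N)` for all `N`. -/
def pdLE (R : Type u) [CommRing R] (M : Type u) [AddCommGroup M] [Module R M] (n : ℕ) : Prop :=
  ∀ N : ModuleCat.{u} R,
    IsZero (((Ext R (ModuleCat.{u} R) (n + 1)).obj (Opposite.op (ModuleCat.of R M))).obj N)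

/-- `fdLE R M n` : the flat dimension of the `R`-module `M` is at most `n`,
expressed by the vanishing of `Tor_{n+1}(M, N)` for all `N`. -/
def fdLE (R : Type u) [CommRing R] (M : Type u) [AddCommGroup M] [Module R M] (n : ℕ) : Prop :=
  ∀ N : ModuleCat.{u} R,
    IsZero (((Tor' (ModuleCat.{u} R) (n + 1)).obj (ModuleCat.of R M)).obj N)

/-- A commutative ring `R` is strong `n`-perfect if every `R`-module of flat dimension
at most `n` has projective dimension at most `n`. -/
def IsStrongNPerfect (R : Type u) [CommRing R] (n : ℕ) : Prop :=
  ∀ (M : Type u) [AddCommGroup M] [Module R M], fdLE R M n → pdLE R M n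

open TensorProduct

lemma ext_isZero_iff {R : Type u} [CommRing R] {M : ModuleCat.{u} R} (P : ProjectiveResolution M)
    (N : ModuleCat.{u} R) (n : ℕ) :
    IsZero (((Ext R (ModuleCat.{u} R) (n + 1)).obj (Opposite.op M)).obj N) ↔
    ∀ f : P.complex.X (n+1) ⟶ N, P.complex.d (n+2) (n+1) ≫ f = 0 →
      ∃ g : P.complex.X n ⟶ N, P.complex.d (n+1) n ≫ g = f := by
  rw [(P.isoExt (R := R) (n+1) N).isZero_iff, ← HomologicalComplex.exactAt_iff_isZero_homology,
    HomologicalComplex.exactAt_iff' _ n (n+1) (n+2) (by simp) (by simp),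
    ShortComplex.moduleCat_exact_iff]
  exact Iff.rfl

lemma tor_isZero_iff {R : Type u} [CommRing R] {M : ModuleCat.{u} R} (P : ProjectiveResolution M)
    (N : ModuleCat.{u} R) (n : ℕ) :
    IsZero (((Tor' (ModuleCat.{u} R) (n + 1)).obj M).obj N) ↔
    Function.Exact ((P.complex.d (n+2) (n+1)).hom.rTensor N)
      ((P.complex.d (n+1) n).hom.rTensor N) := by
  refine (P.isoLeftDerivedObj ((MonoidalCategory.tensoringRight _).obj N) (n+1)).isZero_iff.trans ?_
  erw [← HomologicalComplex.exactAt_iff_isZero_homology,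
    HomologicalComplex.exactAt_iff' _ (n+2) (n+1) n (by simp) (by simp),
    ShortComplex.ShortExact.moduleCat_exact_iff_function_exact]
  exact Iff.rfl

lemma homology_smul_id {R : Type u} [CommRing R] (K : ChainComplex (ModuleCat.{u} R) ℕ) (i : ℕ)
    (r : R) : (HomologicalComplex.homologyFunctor _ _ i).map (r • 𝟙 K) = r • 𝟙 (K.homology i) := by
  have h1 : (HomologicalComplex.shortComplexFunctor _ _ i).map (r • 𝟙 K) = r • 𝟙 (K.sc i) := by
    ext1 <;> rfl
  change ShortComplex.homologyMap ((HomologicalComplex.shortComplexFunctor _ _ i).map (r • 𝟙 K)) = _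
  rw [h1, ShortComplex.homologyMap_smul, ShortComplex.homologyMap_id]
  rfl

lemma tor_smul {R : Type u} [CommRing R] (M : ModuleCat.{u} R)
    (N : ModuleCat.{u} R) (n : ℕ) (r : R) :
    ((Tor' (ModuleCat.{u} R) (n + 1)).map (r • 𝟙 M)).app N =
      r • 𝟙 (((Tor' (ModuleCat.{u} R) (n + 1)).obj M).obj N) := by
  let P := projectiveResolution M
  let F := ((MonoidalCategory.tensoringRight (ModuleCat.{u} R)).obj N)
  change (F.leftDerived (n+1)).map (r • 𝟙 M) = r • 𝟙 _
  have hw : (r • 𝟙 P.complex) ≫ P.π = P.π ≫ (ChainComplex.single₀ _).map (r • 𝟙 M) := by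
    ext1
    refine (Linear.smul_comp _ _ _ _ _ _).trans ?_
    refine Eq.trans ?_ (congrArg (P.π.f 0 ≫ ·) (ChainComplex.single₀_map_f_zero (r • 𝟙 M)).symm)
    refine Eq.trans ?_ (Linear.comp_smul _ _ _ _ _ _).symm
    refine congrArg (r • ·) ?_
    exact (Category.id_comp _).trans (Category.comp_id _).symm
  rw [F.leftDerived_map_eq (n+1) (r • 𝟙 M) (P := P) (Q := P) (r • 𝟙 P.complex) hw]
  have : (F.mapHomologicalComplex _ ⋙ HomologicalComplex.homologyFunctor _ _ (n+1)).map
      (r • 𝟙 P.complex) = r • 𝟙 _ := by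
    have h1 : (F.mapHomologicalComplex (ComplexShape.down ℕ)).map (r • 𝟙 P.complex) = r • 𝟙 _ := by
      ext1 i
      change F.map (r • 𝟙 _) = r • 𝟙 _
      ext1
      refine TensorProduct.ext' fun x y => ?_
      exact TensorProduct.smul_tmul' r x y
    rw [Functor.comp_map, h1]
    exact homology_smul_id _ _ _
  rw [this]
  simp
  rfl

instance {A B : Type u} [CommRing A] [CommRing B] (f : A →+* B) :
    (ModuleCat.extendScalars.{u,u,u} f).Additive := 
  (ModuleCat.extendRestrictScalarsAdj f).left_adjoint_additive

instance {A B : Type u} [CommRing A] [CommRing B] (f : A →+* B) :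
    (ModuleCat.extendScalars.{u,u,u} f).PreservesProjectiveObjects where
  projective_obj h := (ModuleCat.extendRestrictScalarsAdj f).map_projective _ h

lemma extendScalars_preservesHomology {A B : Type u} [CommRing A] [CommRing B] (f : A →+* B)
    (hf : f.Flat) : 
    (ModuleCat.extendScalars.{u,u,u} f).PreservesHomology := by
  algebraize [f]
  refine ((Functor.exact_tfae (ModuleCat.extendScalars.{u,u,u} f)).out 1 2).mp ?_
  intro S h
  rw [CategoryTheory.ShortComplex.ShortExact.moduleCat_exact_iff_function_exact] at h ⊢
  exact Module.Flat.lTensor_exact B h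

lemma ext_extend {A B : Type u} [CommRing A] [CommRing B] (f : A →+* B)
    (hf : f.Flat) (M : ModuleCat.{u} A) (N : ModuleCat.{u} B) (n : ℕ) :
    IsZero (((Ext B (ModuleCat.{u} B) (n + 1)).obj
      (Opposite.op ((ModuleCat.extendScalars.{u,u,u} f).obj M))).obj N) ↔
    IsZero (((Ext A (ModuleCat.{u} A) (n + 1)).obj (Opposite.op M)).obj
      ((ModuleCat.restrictScalars f).obj N)) := by
  have := extendScalars_preservesHomology f hf
  let P := projectiveResolution M
  let E := ModuleCat.extendScalars.{u,u,u} f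
  let adj := ModuleCat.extendRestrictScalarsAdj.{u,u,u} f
  have hE : IsZero (((Ext B (ModuleCat.{u} B) (n + 1)).obj (Opposite.op (E.obj M))).obj N) ↔
    ∀ f : E.obj (P.complex.X (n+1)) ⟶ N, E.map (P.complex.d (n+2) (n+1)) ≫ f = 0 →
      ∃ g : E.obj (P.complex.X n) ⟶ N, E.map (P.complex.d (n+1) n) ≫ g = f :=
    ext_isZero_iff (E.mapProjectiveResolution P) N n
  rw [ext_isZero_iff P]
  refine hE.trans ?_
  have key : ∀ (i j : ℕ) (g : E.obj (P.complex.X j) ⟶ N),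
    adj.homEquiv _ _ (E.map (P.complex.d i j) ≫ g) = P.complex.d i j ≫ adj.homEquiv _ _ g :=
    fun i j g => adj.homEquiv_naturality_left _ _
  have key0 : ∀ (i : ℕ) , adj.homEquiv (P.complex.X i) N 0 = 0 := by
    intro i
    simp [Adjunction.homEquiv_unit]
  constructor
  · intro h g hg
    obtain ⟨k, hk⟩ := h ((adj.homEquiv _ _).symm g) (by
      apply (adj.homEquiv _ _).injective
      refine (key _ _ _).trans ?_
      rw [key0]; simpa using hg)
    refine ⟨adj.homEquiv _ _ k, ?_⟩
    rw [← key]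
    apply (adj.homEquiv _ _).symm.injective
    simpa using hk
  · intro h g hg
    obtain ⟨k, hk⟩ := h (adj.homEquiv _ _ g) (by
      rw [← key, ← key0]
      exact congrArg _ hg)
    refine ⟨(adj.homEquiv _ _).symm k, ?_⟩
    apply (adj.homEquiv _ _).injective
    refine (key _ _ _).trans ?_
    simpa using hk

lemma exact_baseChange_rTensor_iff (A B : Type u) [CommRing A] [CommRing B] [Algebra A B]
    {X Y Z : Type u} [AddCommGroup X] [AddCommGroup Y] [AddCommGroup Z]
    [Module A X] [Module A Y] [Module A Z] (g : X →ₗ[A] Y) (h : Y →ₗ[A] Z)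
    (N : Type u) [AddCommGroup N] [Module A N] [Module B N] [IsScalarTower A B N] :
    Function.Exact ((g.baseChange B).rTensor N) ((h.baseChange B).rTensor N) ↔
      Function.Exact (g.rTensor N) (h.rTensor N) := by
  let e (X : Type u) [AddCommGroup X] [Module A X] : (B ⊗[A] X) ⊗[B] N ≃+ X ⊗[A] N :=
    ((TensorProduct.comm B (B ⊗[A] X) N).trans
      (AlgebraTensorModule.cancelBaseChange A B B N X)).toAddEquiv.trans
      (TensorProduct.comm A N X).toAddEquiv
  have he (X Y : Type u) [AddCommGroup X] [Module A X] [AddCommGroup Y] [Module A Y]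
      (g : X →ₗ[A] Y) (x : (B ⊗[A] X) ⊗[B] N) :
      e Y ((g.baseChange B).rTensor N x) = g.rTensor N (e X x) := by
    induction x with
    | zero => simp
    | add x y hx hy => simp only [map_add, hx, hy]
    | tmul x n =>
      induction x with
      | zero => simp
      | add x y hx hy => simp only [map_add, add_tmul, hx, hy]
      | tmul b x => simp [e]
  constructor
  · intro H y
    obtain ⟨y, rfl⟩ := (e Y).surjective y
    rw [← he, EmbeddingLike.map_eq_zero_iff, H y]
    constructor
    · rintro ⟨x, rfl⟩
      exact ⟨e X x, (he _ _ _ _).symm⟩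
    · rintro ⟨x, hx⟩
      obtain ⟨x, rfl⟩ := (e X).surjective x
      exact ⟨x, (e Y).injective (by rw [he, hx])⟩
  · intro H y
    rw [← EmbeddingLike.map_eq_zero_iff (f := e Z), he, H (e Y y)]
    constructor
    · rintro ⟨x, hx⟩
      obtain ⟨x, rfl⟩ := (e X).surjective x
      exact ⟨x, (e Y).injective (by rw [he, hx])⟩
    · rintro ⟨x, rfl⟩
      exact ⟨e X x, (he _ _ _ _).symm⟩

lemma exact_lTensor_rTensor (A : Type u) [CommRing A]
    {X Y Z : Type u} [AddCommGroup X] [AddCommGroup Y] [AddCommGroup Z]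
    [Module A X] [Module A Y] [Module A Z] (g : X →ₗ[A] Y) (h : Y →ₗ[A] Z)
    (B N : Type u) [AddCommGroup N] [Module A N] [AddCommGroup B] [Module A B]
    (H : Function.Exact (g.rTensor (B ⊗[A] N)) (h.rTensor (B ⊗[A] N))) :
    Function.Exact ((g.rTensor N).lTensor B) ((h.rTensor N).lTensor B) := by
  refine (Function.Exact.iff_of_ladder_linearEquiv
    (e₁ := TensorProduct.leftComm A B X N)
    (e₂ := TensorProduct.leftComm A B Y N)
    (e₃ := TensorProduct.leftComm A B Z N) ?_ ?_).mp H
  all_goals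
    ext
    simp

lemma tor_extend {A B : Type u} [CommRing A] [CommRing B] (f : A →+* B)
    (hf : f.Flat) (M : ModuleCat.{u} A) (N : ModuleCat.{u} B) (n : ℕ) :
    IsZero (((Tor' (ModuleCat.{u} B) (n + 1)).obj
      ((ModuleCat.extendScalars.{u,u,u} f).obj M)).obj N) ↔
    IsZero (((Tor' (ModuleCat.{u} A) (n + 1)).obj M).obj
      ((ModuleCat.restrictScalars f).obj N)) := by
  have := extendScalars_preservesHomology f hf
  let P := projectiveResolution M
  let E := ModuleCat.extendScalars.{u,u,u} f
  rw [tor_isZero_iff P]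
  refine (tor_isZero_iff (E.mapProjectiveResolution P) N n).trans ?_
  let := f.toAlgebra
  let : Module A N := Module.compHom N f
  have : IsScalarTower A B N := ⟨fun a b x => mul_smul (f a) b x⟩
  exact exact_baseChange_rTensor_iff A B (P.complex.d (n+2) (n+1)).hom
    (P.complex.d (n+1) n).hom N

lemma extend_tor_isZero {A B : Type u} [CommRing A] [CommRing B] (f : A →+* B)
    (hf : f.Flat) (M : ModuleCat.{u} A) (N : ModuleCat.{u} A) (n : ℕ)
    (h : IsZero (((Tor' (ModuleCat.{u} B) (n + 1)).obj
      ((ModuleCat.extendScalars.{u,u,u} f).obj M)).obj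
        ((ModuleCat.extendScalars.{u,u,u} f).obj N))) :
    IsZero ((ModuleCat.extendScalars.{u,u,u} f).obj
      (((Tor' (ModuleCat.{u} A) (n + 1)).obj M).obj N)) := by
  have := extendScalars_preservesHomology f hf
  let P := projectiveResolution M
  let E := ModuleCat.extendScalars.{u,u,u} f
  let F := (MonoidalCategory.tensoringRight (ModuleCat.{u} A)).obj N
  rw [tor_extend f hf, tor_isZero_iff P] at h
  let := f.toAlgebra
  have h2 := exact_lTensor_rTensor A (P.complex.d (n+2) (n+1)).hom
    (P.complex.d (n+1) n).hom B N h
  let C := (F.mapHomologicalComplex (ComplexShape.down ℕ)).obj P.complex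
  let S := C.sc' (n+2) (n+1) n
  have hS : (S.map E).Exact := by
    rw [ShortComplex.ShortExact.moduleCat_exact_iff_function_exact]
    exact h2
  have h3 : IsZero (E.obj S.homology) :=
    (S.mapHomologyIso E).symm.isZero_iff.mpr ((S.map E).exact_iff_isZero_homology.mp hS)
  refine h3.of_iso (E.mapIso ?_)
  refine (P.isoLeftDerivedObj F (n+1)) ≪≫ ?_
  exact ShortComplex.homologyMapIso (C.isoSc' (n+2) (n+1) n (by simp) (by simp))

lemma subsingleton_tensor (A B : Type u) [CommRing A] [CommRing B] [Algebra A B]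
    (H : ModuleCat.{u} A)
    (h : IsZero ((ModuleCat.extendScalars.{u,u,u} (algebraMap A B)).obj H)) :
    Subsingleton (B ⊗[A] H) := by
  have h1 := ModuleCat.subsingleton_of_isZero h
  let e : B ≃ₗ[A] (ModuleCat.restrictScalars (algebraMap A B)).obj (ModuleCat.of B B) :=
    LinearEquiv.mk (LinearMap.mk ⟨fun x => x, fun x y => rfl⟩
      (fun a b => Algebra.smul_def a b)) (fun x => x) (fun _ => rfl) (fun _ => rfl)
  exact (TensorProduct.congr e (LinearEquiv.refl A H)).toEquiv.subsingleton_congr.mpr h1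

lemma fdLE_iso_aux {R : Type u} [CommRing R] {M M' : ModuleCat.{u} R} (e : M ≅ M') (N : ModuleCat.{u} R)
    (n : ℕ) (h : IsZero (((Tor' (ModuleCat.{u} R) n).obj M).obj N)) :
    IsZero (((Tor' (ModuleCat.{u} R) n).obj M').obj N) :=
  h.of_iso (((Tor' (ModuleCat.{u} R) n).mapIso e.symm).app N)

lemma ext_iso_aux {R : Type u} [CommRing R] {M M' : ModuleCat.{u} R} (e : M ≅ M')
    (N : ModuleCat.{u} R)
    (n : ℕ) (h : IsZero (((Ext R (ModuleCat.{u} R) n).obj (Opposite.op M)).obj N)) :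
    IsZero (((Ext R (ModuleCat.{u} R) n).obj (Opposite.op M')).obj N) :=
  h.of_iso (((Ext R (ModuleCat.{u} R) n).mapIso e.op).app N)

lemma forward {A B : Type u} [CommRing A] [CommRing B] (f : A →+* B) (hf : f.Flat)
    [(ModuleCat.restrictScalars.{u} f).Full]
    (n : ℕ)
    (hTor : ∀ (M : ModuleCat.{u} B) (N : ModuleCat.{u} A),
      IsZero ((ModuleCat.extendScalars.{u,u,u} f).obj
      (((Tor' (ModuleCat.{u} A) (n + 1)).obj ((ModuleCat.restrictScalars f).obj M)).obj N)) →
      IsZero (((Tor' (ModuleCat.{u} A) (n + 1)).obj ((ModuleCat.restrictScalars f).obj M)).obj N))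
    (hA : IsStrongNPerfect A n) : IsStrongNPerfect B n := by
  intro M _ _ hM N
  let M' := ModuleCat.of B M
  let e : (ModuleCat.extendScalars.{u,u,u} f).obj ((ModuleCat.restrictScalars f).obj M') ≅ M' :=
    asIso ((ModuleCat.extendRestrictScalarsAdj f).counit.app M')
  refine ext_iso_aux e N _ ?_
  rw [ext_extend f hf]
  refine hA ((ModuleCat.restrictScalars f).obj M') ?_ _
  intro N'
  refine hTor M' N' ?_
  apply extend_tor_isZero f hf
  exact fdLE_iso_aux e.symm _ _ (hM _)

lemma smul_of_localization (A : Type u) [CommRing A] (S : Submonoid A) {X Y : Type u}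
    [AddCommGroup X] [AddCommGroup Y] [Module (Localization S) X] [Module (Localization S) Y]
    (g : X → Y)
    (hg : ∀ (a : A) (x : X), g (algebraMap A (Localization S) a • x) =
      algebraMap A (Localization S) a • g x) (b : Localization S) (x : X) :
    g (b • x) = b • g x := by
  obtain ⟨a, s, rfl⟩ := IsLocalization.exists_mk'_eq S b
  have hs : IsUnit (algebraMap A (Localization S) s) := IsLocalization.map_units _ s
  refine (hs.smul_left_cancel).mp ?_
  rw [← hg, smul_smul, smul_smul, IsLocalization.mk'_spec']
  exact hg a x

lemma full_localization (A : Type u) [CommRing A] (S : Submonoid A) :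
    (ModuleCat.restrictScalars.{u} (algebraMap A (Localization S))).Full where
  map_surjective {X Y} g := by
    refine ⟨ModuleCat.ofHom (LinearMap.mk ⟨fun x => g.hom x, fun x y => g.hom.map_add x y⟩ ?_), rfl⟩
    exact smul_of_localization A S (fun x : X => (g.hom x : Y)) (fun a x => g.hom.map_smul a x)

lemma full_quotient (A : Type u) [CommRing A] (Q : Ideal A) :
    (ModuleCat.restrictScalars.{u} (algebraMap A (A ⧸ Q))).Full where
  map_surjective {X Y} g := by
    let f := algebraMap A (A ⧸ Q)
    have hg : ∀ (a : A) (x : X), g.hom (f a • x : X) = (f a • (g.hom x : Y) : Y) :=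
      fun a x => g.hom.map_smul a x
    refine ⟨ModuleCat.ofHom (LinearMap.mk ⟨fun x => g.hom x, fun x y => g.hom.map_add x y⟩ ?_), rfl⟩
    intro b x
    obtain ⟨a, rfl⟩ := Ideal.Quotient.mk_surjective b
    exact hg a x

lemma hTor_localization (A : Type u) [CommRing A] (S : Submonoid A)
    (M : ModuleCat.{u} (Localization S)) (N : ModuleCat.{u} A) (n : ℕ)
    (h : IsZero ((ModuleCat.extendScalars.{u,u,u} (algebraMap A (Localization S))).obj
      (((Tor' (ModuleCat.{u} A) (n + 1)).obj
        ((ModuleCat.restrictScalars (algebraMap A (Localization S))).obj M)).obj N))) :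
    IsZero (((Tor' (ModuleCat.{u} A) (n + 1)).obj
      ((ModuleCat.restrictScalars (algebraMap A (Localization S))).obj M)).obj N) := by
  let f := algebraMap A (Localization S)
  let M' := (ModuleCat.restrictScalars f).obj M
  let H := ((Tor' (ModuleCat.{u} A) (n + 1)).obj M').obj N
  change IsZero H
  have hsub : Subsingleton (Localization S ⊗[A] H) := by
    exact subsingleton_tensor _ _ _ h
  have hinj : ∀ s ∈ S, ∀ x : H, s • x = 0 → x = 0 := by
    intro s hs x hx
    have hu : IsUnit (f s) := IsLocalization.map_units _ (⟨s, hs⟩ : S)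
    have : IsIso (s • 𝟙 M') := by
      obtain ⟨b, hb⟩ := hu.exists_left_inv
      let b' : M' ⟶ M' := (ModuleCat.restrictScalars f).map (b • 𝟙 M)
      have e1 : s • 𝟙 M' = (ModuleCat.restrictScalars f).map (f s • 𝟙 M) := rfl
      refine ⟨b', ?_, ?_⟩
      · rw [e1, ← Functor.map_comp, Linear.smul_comp, Linear.comp_smul, smul_smul, mul_comm, hb]
        simp
        rfl
      · rw [e1, ← Functor.map_comp, Linear.smul_comp, Linear.comp_smul, smul_smul, hb]
        simp
        rfl
    have h3 : IsIso (((Tor' (ModuleCat.{u} A) (n + 1)).map (s • 𝟙 M')).app N) := inferInstance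
    rw [tor_smul] at h3
    have h4 := ((ConcreteCategory.isIso_iff_bijective _).mp h3).1
    exact h4 (a₁ := x) (a₂ := 0) (hx.trans (smul_zero (A := H) s).symm)
  refine @ModuleCat.isZero_of_subsingleton _ _ _ ⟨?_⟩
  suffices ∀ x : H, x = 0 from fun x y => (this x).trans (this y).symm
  intro x
  have h5 : (1 : Localization S) ⊗ₜ[A] x = 0 := Subsingleton.elim _ _
  have h6 : IsLocalizedModule S (TensorProduct.mk A (Localization S) H 1) := inferInstance
  obtain ⟨s, hs⟩ := (IsLocalizedModule.eq_zero_iff S (TensorProduct.mk A (Localization S) H 1)).mp h5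
  exact hinj s s.2 x hs

lemma hTor_quotient (A : Type u) [CommRing A] (Q : Ideal A)
    (M : ModuleCat.{u} (A ⧸ Q)) (N : ModuleCat.{u} A) (n : ℕ)
    (h : IsZero ((ModuleCat.extendScalars.{u,u,u} (algebraMap A (A ⧸ Q))).obj
      (((Tor' (ModuleCat.{u} A) (n + 1)).obj
        ((ModuleCat.restrictScalars (algebraMap A (A ⧸ Q))).obj M)).obj N))) :
    IsZero (((Tor' (ModuleCat.{u} A) (n + 1)).obj
      ((ModuleCat.restrictScalars (algebraMap A (A ⧸ Q))).obj M)).obj N) := by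
  let f := algebraMap A (A ⧸ Q)
  let M' := (ModuleCat.restrictScalars f).obj M
  let H := ((Tor' (ModuleCat.{u} A) (n + 1)).obj M').obj N
  change IsZero H
  have hsub : Subsingleton ((A ⧸ Q) ⊗[A] H) := by
    exact subsingleton_tensor _ _ _ h
  have hz : ∀ s ∈ Q, ∀ x : H, s • x = 0 := by
    intro s hs x
    have h0 : f s = 0 := Ideal.Quotient.eq_zero_iff_mem.mpr hs
    have e1 : s • 𝟙 M' = (0 : A) • 𝟙 M' := by
      have : s • 𝟙 M' = (ModuleCat.restrictScalars f).map (f s • 𝟙 M) := rfl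
      rw [this, h0]
      simp
    have e2 := tor_smul M' N n s
    rw [e1, tor_smul] at e2
    have := congrArg (fun t => t.hom x) e2
    exact this.symm.trans (zero_smul A (x : H))
  refine @ModuleCat.isZero_of_subsingleton _ _ _ ⟨?_⟩
  suffices ∀ x : H, x = 0 from fun x y => (this x).trans (this y).symm
  intro x
  have hbot : Q • (⊤ : Submodule A H) = ⊥ := by
    rw [eq_bot_iff, Submodule.smul_le]
    intro r hr y _
    exact hz r hr y
  have hss : Subsingleton (H ⧸ (Q • (⊤ : Submodule A H))) :=
    (TensorProduct.quotTensorEquivQuotSMul H Q).symm.toEquiv.subsingleton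
  have := (Submodule.Quotient.mk_eq_zero (Q • (⊤ : Submodule A H)) (x := x)).mp
    (Subsingleton.elim _ _)
  rw [hbot] at this
  exact this

lemma ext_mid {R : Type u} [CommRing R] (M N : ModuleCat.{u} R) (K : Submodule R N) (n : ℕ)
    (h1 : IsZero (((Ext R (ModuleCat.{u} R) (n + 1)).obj (Opposite.op M)).obj (ModuleCat.of R K)))
    (h2 : IsZero (((Ext R (ModuleCat.{u} R) (n + 1)).obj (Opposite.op M)).obj
      (ModuleCat.of R (N ⧸ K)))) :
    IsZero (((Ext R (ModuleCat.{u} R) (n + 1)).obj (Opposite.op M)).obj N) := by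
  let P := projectiveResolution M
  rw [ext_isZero_iff P] at h1 h2 ⊢
  intro f hf
  let i : ModuleCat.of R K ⟶ N := ModuleCat.ofHom K.subtype
  let p : N ⟶ ModuleCat.of R (N ⧸ K) := ModuleCat.ofHom K.mkQ
  have hp : Epi p := (ModuleCat.epi_iff_surjective p).mpr K.mkQ_surjective
  have hi : Mono i := (ModuleCat.mono_iff_injective i).mpr K.injective_subtype
  obtain ⟨g, hg⟩ := h2 (f ≫ p) (by rw [← Category.assoc, hf, zero_comp])
  have hPn : Projective (P.complex.X n) := P.projective n
  let g' := Projective.factorThru g p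
  have hg' : (f - P.complex.d (n+1) n ≫ g') ≫ p = 0 := by
    rw [Preadditive.sub_comp, Category.assoc, Projective.factorThru_comp, hg, sub_self]
  let k : P.complex.X (n+1) ⟶ ModuleCat.of R K := ModuleCat.ofHom
    ((f - P.complex.d (n+1) n ≫ g').hom.codRestrict K (fun x => by
      have := congrArg (fun t => t.hom x) hg'
      exact (Submodule.Quotient.mk_eq_zero K).mp this))
  have hk : k ≫ i = f - P.complex.d (n+1) n ≫ g' := rfl
  obtain ⟨l, hl⟩ := h1 k (by
    rw [← cancel_mono i, Category.assoc, hk, Preadditive.comp_sub, hf]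
    simp)
  refine ⟨l ≫ i + g', ?_⟩
  rw [Preadditive.comp_add, ← Category.assoc, hl, hk]
  simp

lemma pure_fix (A : Type u) [CommRing A] (Q : Ideal A) (hpure : Module.Flat A (A ⧸ Q))
    (N : Type u) [AddCommGroup N] [Module A N] (x : N) (hx : x ∈ Q • (⊤ : Submodule A N)) :
    ∃ e ∈ Q, e • x = x := by
  have : Q.Pure := hpure
  induction hx using Submodule.smul_induction_on' with
  | smul q hq n _ =>
    have h1 : q ∈ Q ⊓ Ideal.span {q} := ⟨hq, Ideal.mem_span_singleton_self q⟩
    rw [Ideal.inf_eq_mul_of_pure, Ideal.mem_mul_span_singleton] at h1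
    obtain ⟨e, he, h2⟩ := h1
    exact ⟨e, he, by rw [smul_smul, h2]⟩
  | add x _ y _ hx hy =>
    obtain ⟨a, ha, hax⟩ := hx
    obtain ⟨b, hb, hby⟩ := hy
    refine ⟨a + b - a * b, Q.sub_mem (Q.add_mem ha hb) (Q.mul_mem_right _ ha), ?_⟩
    have e1 : (a + b - a * b) • x = x := by
      rw [sub_smul, add_smul, mul_comm, mul_smul, hax]; abel
    have e2 : (a + b - a * b) • y = y := by
      rw [sub_smul, add_smul, mul_smul, hby]; abel
    rw [smul_add, e1, e2]

lemma bij_S (A : Type u) [CommRing A] (S : Submonoid A)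
    (hinj : Function.Injective (algebraMap A (Localization S)))
    (Q : Ideal A) (hpure : Module.Flat A (A ⧸ Q))
    (hQB : (Q.map (algebraMap A (Localization S)) : Set (Localization S)) =
      algebraMap A (Localization S) '' Q)
    (N : Type u) [AddCommGroup N] [Module A N] :
    IsLocalizedModule S (LinearMap.id (R := A) (M := (Q • (⊤ : Submodule A N) : Submodule A N))) := by
  have div : ∀ s ∈ S, ∀ q ∈ Q, ∃ q' ∈ Q, s * q' = q := by
    intro s hs q hq
    have h1 : IsLocalization.mk' (Localization S) q ⟨s, hs⟩ ∈
        (Q.map (algebraMap A (Localization S)) : Set (Localization S)) := by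
      rw [IsLocalization.mk'_eq_mul_mk'_one]
      exact Ideal.mul_mem_right _ _ (Ideal.mem_map_of_mem _ hq)
    rw [hQB] at h1
    obtain ⟨q', hq', h2⟩ := h1
    refine ⟨q', hq', hinj ?_⟩
    rw [map_mul, h2]
    exact IsLocalization.mk'_spec' (Localization S) q ⟨s, hs⟩
  refine ⟨?_, ?_, ?_⟩
  · intro s
    rw [Module.End.isUnit_iff]
    constructor
    · rw [injective_iff_map_eq_zero]
      rintro ⟨x, hx⟩ h0
      have h0' : (s : A) • x = 0 := congrArg Subtype.val h0
      obtain ⟨e, he, hex⟩ := pure_fix A Q hpure N x hx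
      obtain ⟨e', he', rfl⟩ := div s s.2 e he
      ext
      change x = 0
      rw [← hex, mul_comm, mul_smul, h0', smul_zero]
    · rintro ⟨x, hx⟩
      obtain ⟨e, he, hex⟩ := pure_fix A Q hpure N x hx
      obtain ⟨e', he', rfl⟩ := div s s.2 e he
      refine ⟨⟨e' • x, Submodule.smul_mem _ _ hx⟩, ?_⟩
      ext
      change (s : A) • e' • x = x
      rw [smul_smul, hex]
  · intro y
    exact ⟨(y, 1), by simp⟩
  · intro x y h
    exact ⟨1, by simpa using h⟩

def mkIso {A : Type u} [CommRing A] (X Y : ModuleCat.{u} A) (e : X ≃+ Y)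
    (h : ∀ (a : A) (x : X), e (a • x) = a • e x) : X ≅ Y :=
  (e.toLinearEquiv h).toModuleIso

def restrictIso (A B : Type u) [CommRing A] [CommRing B] [Algebra A B] (K : Type u)
    [AddCommGroup K] [Module A K] [Module B K] [IsScalarTower A B K] :
    (ModuleCat.restrictScalars.{u} (algebraMap A B)).obj (ModuleCat.of B K) ≅ ModuleCat.of A K :=
  mkIso ((ModuleCat.restrictScalars.{u} (algebraMap A B)).obj (ModuleCat.of B K))
    (ModuleCat.of A K) (AddEquiv.refl K) (fun a x => algebraMap_smul B a (show K from x))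

lemma backward_ext {A B : Type u} [CommRing A] [CommRing B] (f : A →+* B) (hf : f.Flat) (n : ℕ)
    (hB : IsStrongNPerfect B n) (M : ModuleCat.{u} A) (hM : fdLE A M n) (N : ModuleCat.{u} B) :
    IsZero (((Ext A (ModuleCat.{u} A) (n + 1)).obj (Opposite.op M)).obj
      ((ModuleCat.restrictScalars.{u} f).obj N)) := by
  rw [← ext_extend f hf]
  let M' := (ModuleCat.extendScalars.{u,u,u} f).obj M
  exact @hB M' M'.isAddCommGroup M'.isModule (fun N' => (tor_extend f hf M N' n).mpr (hM _)) N

theorem strongNPerfect_iff_localization_and_quotient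
    (A : Type u) [CommRing A] (S : Submonoid A)
    (hinj : Function.Injective (algebraMap A (Localization S)))
    (Q : Ideal A) (hpure : Module.Flat A (A ⧸ Q))
    (hQB : (Q.map (algebraMap A (Localization S)) : Set (Localization S)) =
      algebraMap A (Localization S) '' Q)
    (n : ℕ) :
    IsStrongNPerfect A n ↔
      IsStrongNPerfect (Localization S) n ∧ IsStrongNPerfect (A ⧸ Q) n := by
  have hfS : (algebraMap A (Localization S)).Flat :=
    (RingHom.flat_algebraMap_iff).mpr (IsLocalization.flat (Localization S) S)
  have hfQ : (algebraMap A (A ⧸ Q)).Flat := (RingHom.flat_algebraMap_iff).mpr hpure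
  have := full_localization A S
  have := full_quotient A Q
  constructor
  · intro hA
    exact ⟨forward _ hfS n (fun M N => hTor_localization A S M N n) hA,
      forward _ hfQ n (fun M N => hTor_quotient A Q M N n) hA⟩
  · rintro ⟨hB, hC⟩ M _ _ hM N
    refine ext_mid _ N (Q • ⊤) n ?_ ?_
    · have hloc := bij_S A S hinj Q hpure hQB N
      let K : Submodule A N := Q • ⊤
      have e0 : LocalizedModule S K ≃ₗ[A] K := IsLocalizedModule.iso S LinearMap.id
      let e := restrictIso A (Localization S) (LocalizedModule S K) ≪≫ e0.toModuleIso
      refine IsZero.of_iso ?_ (((Ext A (ModuleCat.{u} A) (n + 1)).obj _).mapIso e.symm)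
      exact backward_ext _ hfS n hB (ModuleCat.of A M) hM _
    · let e := restrictIso A (A ⧸ Q) (N ⧸ (Q • ⊤ : Submodule A N))
      refine IsZero.of_iso ?_ (((Ext A (ModuleCat.{u} A) (n + 1)).obj _).mapIso e.symm)
      exact backward_ext _ hfQ n hC (ModuleCat.of A M) hM _
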